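/- The cardinality N_{m,n} of the stabilizer Γ̄_{m,n} is given by: N_{0,0} = q³(q+1)(q²+q+1)(q−1)²; N_{m,0} = q^{2m+3}(q+1)(q−1)² for m > 0; N_{m,n} = q^{2m+3}(q−1)² for m > n > 0; and N_{m,m} = q^{2m+3}(q+1)(q−1)² for m > 0. -/

import Mathlib

set_option linter.unusedSectionVars false

noncomputable section

open Matrix Polynomial

variable (K : Type) [Field K] [Fintype K]

/-- `u ∈ 𝔽_q((u))`, playing the role of `t⁻¹`. -/
def uu : LaurentSeries K := HahnSeries.single 1 1

/-- `t = u⁻¹`, so that `LaurentSeries K` is identified with `𝔽_q((t⁻¹))`. -/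
def tt : LaurentSeries K := (uu K)⁻¹

/-- The valuation ring `O = 𝔽_q[[t⁻¹]]`, the subring of power series in `u`. -/
def Osub : Subring (LaurentSeries K) := (HahnSeries.ofPowerSeries ℤ K).range

/-- The ring `R = 𝔽_q[t]`, the image of the polynomial ring under `X ↦ t`. -/
def Rsub : Subring (LaurentSeries K) :=
  (Polynomial.eval₂RingHom (HahnSeries.C : K →+* LaurentSeries K) (tt K)).range

/-- Membership in `Γ_d`: all entries of `g` and of `g⁻¹` lie in `R = 𝔽_q[t]`. -/
def memGamma {d : ℕ} (g : GL (Fin d) (LaurentSeries K)) : Prop :=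
  (∀ i j, (g : Matrix (Fin d) (Fin d) (LaurentSeries K)) i j ∈ Rsub K) ∧
  (∀ i j, ((g⁻¹ : GL (Fin d) (LaurentSeries K)) : Matrix (Fin d) (Fin d) (LaurentSeries K)) i j
      ∈ Rsub K)

/-- Membership in `W_d`: all entries of `g` and of `g⁻¹` lie in `O = 𝔽_q[[t⁻¹]]`. -/
def memW {d : ℕ} (g : GL (Fin d) (LaurentSeries K)) : Prop :=
  (∀ i j, (g : Matrix (Fin d) (Fin d) (LaurentSeries K)) i j ∈ Osub K) ∧
  (∀ i j, ((g⁻¹ : GL (Fin d) (LaurentSeries K)) : Matrix (Fin d) (Fin d) (LaurentSeries K)) i j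
      ∈ Osub K)

/-- The subgroup of scalar matrices in `GL(3,F)`. -/
def scalarSubgroup : Subgroup (GL (Fin 3) (LaurentSeries K)) :=
  (Units.map ((Matrix.scalar (Fin 3) :
      LaurentSeries K →+* Matrix (Fin 3) (Fin 3) (LaurentSeries K))).toMonoidHom).range

instance scalarSubgroup_normal : (scalarSubgroup K).Normal := by
  constructor
  intro x hx g
  obtain ⟨c, rfl⟩ := hx
  refine ⟨c, ?_⟩
  have h : Commute ((Matrix.scalar (Fin 3)) (c : LaurentSeries K))
      (g : Matrix (Fin 3) (Fin 3) (LaurentSeries K)) :=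
    Matrix.scalar_commute (c : LaurentSeries K) (fun r => Commute.all _ r) _
  symm
  rw [mul_inv_eq_iff_eq_mul]
  apply Units.ext
  simpa [Units.coe_map] using h.eq.symm

/-- `PGL(3,F)`, the quotient of `GL(3,F)` by the subgroup of scalar matrices. -/
def PGL3 := GL (Fin 3) (LaurentSeries K) ⧸ scalarSubgroup K

instance : Group (PGL3 K) := QuotientGroup.Quotient.group (scalarSubgroup K)

/-- The projection `GL(3,F) → PGL(3,F)`. -/
def projPGL : GL (Fin 3) (LaurentSeries K) →* PGL3 K := QuotientGroup.mk' (scalarSubgroup K)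

/-- `Γ̄`, the image of `Γ₃` in `PGL(3,F)`. -/
def GammaBar : Set (PGL3 K) := projPGL K '' {g | memGamma K g}

/-- `W̄`, the image of `W₃` in `PGL(3,F)`. -/
def WBar : Set (PGL3 K) := projPGL K '' {g | memW K g}

lemma tt_ne_zero : tt K ≠ 0 := by
  have h : uu K ≠ 0 := HahnSeries.single_ne_zero one_ne_zero
  simpa [tt] using inv_ne_zero h

lemma diag_det_ne_zero (m n : ℕ) :
    (Matrix.diagonal ![tt K ^ m, tt K ^ n, 1] :
      Matrix (Fin 3) (Fin 3) (LaurentSeries K)).det ≠ 0 := by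
  rw [Matrix.det_diagonal]
  simp [Fin.prod_univ_three, pow_ne_zero, tt_ne_zero K]

/-- `x̄_{m,n} ∈ PGL(3,F)`, the image of the diagonal matrix `diag(t^m, t^n, 1)`. -/
def xbar (m n : ℕ) : PGL3 K :=
  projPGL K (Matrix.GeneralLinearGroup.mkOfDetNeZero _ (diag_det_ne_zero K m n))

/-- The stabilizer `Γ̄_{m,n} = {γ ∈ Γ̄ : x̄_{m,n}⁻¹ γ x̄_{m,n} ∈ W̄}`. -/
def stab (m n : ℕ) : Set (PGL3 K) :=
  {γ ∈ GammaBar K | (xbar K m n)⁻¹ * γ * xbar K m n ∈ WBar K}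

/-- The constants `𝔽_q ⊆ F`. -/
def Fqconst : Subring (LaurentSeries K) := (HahnSeries.C : K →+* LaurentSeries K).range

/-- `P^k(t)`: polynomials in `t` of degree at most `k`. -/
def Pdeg (k : ℕ) : Set (LaurentSeries K) :=
  {x | ∃ p : Polynomial K, p.natDegree ≤ k ∧ Polynomial.eval₂ HahnSeries.C (tt K) p = x}


abbrev LS := LaurentSeries K
def iota : K[X] →+* LaurentSeries K :=
  Polynomial.eval₂RingHom (HahnSeries.C : K →+* LaurentSeries K) (tt K)

lemma tt_eq : tt K = HahnSeries.single (-1) 1 := by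
  simp [tt, uu]

lemma iota_coeff (p : K[X]) (k : ℕ) : (iota K p).coeff (-(k:ℤ)) = p.coeff k := by
  induction p using Polynomial.induction_on' with
  | add p q hp hq => simp [hp, hq]
  | monomial n a =>
    have : iota K (monomial n a) = HahnSeries.single (-(n:ℤ)) a := by
      simp only [iota, Polynomial.coe_eval₂RingHom, Polynomial.eval₂_monomial, tt_eq]
      simp [HahnSeries.C_apply, HahnSeries.single_pow]
    rw [this, Polynomial.coeff_monomial, HahnSeries.coeff_single]
    simp [eq_comm]

lemma iota_coeff_pos (p : K[X]) (z : ℤ) (hz : 0 < z) : (iota K p).coeff z = 0 := by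
  induction p using Polynomial.induction_on' with
  | add p q hp hq => simp [hp, hq]
  | monomial n a =>
    have : iota K (monomial n a) = HahnSeries.single (-(n:ℤ)) a := by
      simp only [iota, Polynomial.coe_eval₂RingHom, Polynomial.eval₂_monomial, tt_eq]
      simp [HahnSeries.C_apply, HahnSeries.single_pow]
    rw [this, HahnSeries.coeff_single_of_ne]
    omega

lemma iota_inj : Function.Injective (iota K) := by
  intro p q h
  ext k
  rw [← iota_coeff, ← iota_coeff, h]

lemma mem_Osub (x : LaurentSeries K) : x ∈ Osub K ↔ ∀ z : ℤ, z < 0 → x.coeff z = 0 := by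
  constructor
  · rintro ⟨p, rfl⟩ z hz
    rw [HahnSeries.ofPowerSeries_apply]
    apply HahnSeries.embDomain_of_notMem_range
    rintro ⟨n, hn⟩
    simp at hn
    omega
  · intro h
    refine ⟨PowerSeries.mk fun n => x.coeff n, ?_⟩
    ext z
    rcases lt_or_ge z 0 with hz | hz
    · rw [h z hz, HahnSeries.ofPowerSeries_apply]
      apply HahnSeries.embDomain_of_notMem_range
      rintro ⟨n, hn⟩
      simp at hn
      omega
    · lift z to ℕ using hz
      simp [HahnSeries.ofPowerSeries_apply_coeff]

lemma mem_Rsub (x : LaurentSeries K) : x ∈ Rsub K ↔ ∃ p, iota K p = x := Iff.rfl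

lemma iota_mem_O (p : K[X]) (a b : ℕ) : (tt K ^ a)⁻¹ * iota K p * tt K ^ b ∈ Osub K ↔
    ∀ k, a < k + b → p.coeff k = 0 := by
  have : (tt K ^ a)⁻¹ * iota K p * tt K ^ b = iota K p * HahnSeries.single ((a:ℤ) - b) 1 := by
    have h : (HahnSeries.single ((a:ℤ) - b) (1:K)) = tt K ^ b * (tt K ^ a)⁻¹ := by
      rw [eq_mul_inv_iff_mul_eq₀ (pow_ne_zero _ (tt_ne_zero K)), tt_eq, HahnSeries.single_pow,
        HahnSeries.single_pow, HahnSeries.single_mul_single]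
      congr 1
      · simp only [nsmul_eq_mul]; ring
      · simp
    rw [h]
    ring
  rw [this, mem_Osub]
  have hc : ∀ z, (iota K p * HahnSeries.single ((a:ℤ) - b) 1).coeff z
      = (iota K p).coeff (z - (a - b)) := by
    intro z
    have := HahnSeries.coeff_mul_single_add (r := (1:K)) (x := iota K p) (a := z - (a-b)) (b := (a:ℤ)-b)
    simpa using this
  simp only [hc]
  constructor
  · intro h k hk
    have := h (a - b - k) (by omega)
    rw [← iota_coeff, ← this]
    congr 1; ring
  · intro h z hz
    rcases lt_or_ge 0 (z - ((a:ℤ) - b)) with h' | h'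
    · exact iota_coeff_pos K p _ h'
    · obtain ⟨k, hk⟩ : ∃ k : ℕ, z - ((a:ℤ)-b) = -(k:ℤ) := ⟨(-(z - ((a:ℤ)-b))).toNat, by omega⟩
      rw [hk, iota_coeff]
      apply h; omega

lemma O_of_cube (c : LaurentSeries K) (h : c ^ 3 ∈ Osub K) : c ∈ Osub K := by
  by_cases hc : c = 0
  · rw [hc]; exact zero_mem _
  rw [mem_Osub] at h ⊢
  have h3 : 0 ≤ (c^3).order := by
    by_contra hh
    exact HahnSeries.coeff_order_eq_zero.not.2 (pow_ne_zero 3 hc) (h _ (by omega))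
  rw [HahnSeries.order_pow] at h3
  intro z hz
  apply HahnSeries.coeff_eq_zero_of_lt_order
  simp at h3
  omega

lemma map_subring_inv {F : Type} [Field F] (T : Subring F) (M : Matrix (Fin 3) (Fin 3) F)
    (hM : ∀ i j, M i j ∈ T) : M.det ∈ T ∧ ∀ i j, M.adjugate i j ∈ T := by
  let N : Matrix (Fin 3) (Fin 3) T := fun i j => ⟨M i j, hM i j⟩
  have h : M = T.subtype.mapMatrix N := by ext i j; rfl
  constructor
  · rw [h, ← RingHom.map_det]; exact (N.det).2
  · intro i j
    rw [h, ← RingHom.map_adjugate]; exact (N.adjugate i j).2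

def expo (m n : ℕ) : Fin 3 → ℕ := ![m, n, 0]

def SS (m n : ℕ) : Set (Matrix (Fin 3) (Fin 3) K[X]) :=
  {A | (∀ i j k, expo m n i < k + expo m n j → (A i j).coeff k = 0) ∧ IsUnit A.det}

def toGL (A : Matrix (Fin 3) (Fin 3) K[X]) (h : IsUnit A.det) : GL (Fin 3) (LaurentSeries K) :=
  Matrix.GeneralLinearGroup.map (iota K) (Matrix.nonsingInvUnit A h)

lemma toGL_apply (A : Matrix (Fin 3) (Fin 3) K[X]) (h : IsUnit A.det) (i j) :
  (toGL K A h : Matrix (Fin 3) (Fin 3) (LaurentSeries K)) i j = iota K (A i j) := rfl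

lemma toGL_inv_apply (A : Matrix (Fin 3) (Fin 3) K[X]) (h : IsUnit A.det) (i j) :
  ((toGL K A h)⁻¹ : GL (Fin 3) (LaurentSeries K)).1 i j = iota K (A⁻¹ i j) := by
  unfold toGL
  rw [← map_inv]
  rfl

lemma toGL_gamma (A : Matrix (Fin 3) (Fin 3) K[X]) (h : IsUnit A.det) : memGamma K (toGL K A h) :=
  ⟨fun i j => ⟨A i j, rfl⟩, fun i j => ⟨A⁻¹ i j, (toGL_inv_apply K A h i j).symm⟩⟩

lemma gamma_toGL (g : GL (Fin 3) (LaurentSeries K)) (hg : memGamma K g) :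
    ∃ A h, g = toGL K A h := by
  obtain ⟨h1, h2⟩ := hg
  simp only [mem_Rsub] at h1 h2
  choose A hA using h1
  choose B hB using h2
  have hAB : (Matrix.of A) * (Matrix.of B) = 1 := by
    ext i j : 1
    apply iota_inj K
    have h0 : g.1 * (g⁻¹ : GL (Fin 3) (LaurentSeries K)).1 = 1 := Units.mul_inv g
    have := congrFun (congrFun h0 i) j
    simp only [Matrix.mul_apply, ← hA, ← hB] at this
    rw [Matrix.mul_apply, map_sum]
    simp only [map_mul, Matrix.of_apply]
    rw [this, Matrix.one_apply, Matrix.one_apply]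
    split_ifs <;> simp
  have hu : IsUnit (Matrix.of A).det := by
    apply IsUnit.of_mul_eq_one (Matrix.of B).det
    rw [← Matrix.det_mul, hAB, Matrix.det_one]
  refine ⟨Matrix.of A, hu, ?_⟩
  ext i j : 2
  rw [toGL_apply, Matrix.of_apply, hA]

def xx (m n : ℕ) : GL (Fin 3) (LaurentSeries K) :=
  Matrix.GeneralLinearGroup.mkOfDetNeZero _ (diag_det_ne_zero K m n)

lemma xx_val (m n : ℕ) : (xx K m n).1 = Matrix.diagonal fun i => tt K ^ expo m n i := by
  change Matrix.diagonal _ = _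
  congr 1
  ext i : 1
  fin_cases i <;> simp [expo]

lemma xx_inv_val (m n : ℕ) : ((xx K m n)⁻¹ : GL (Fin 3) (LaurentSeries K)).1
    = Matrix.diagonal fun i => (tt K ^ expo m n i)⁻¹ := by
  rw [Units.inv_eq_of_mul_eq_one_right]
  rw [xx_val, Matrix.diagonal_mul_diagonal, ← Matrix.diagonal_one]
  congr 1
  ext i : 1
  exact mul_inv_cancel₀ (pow_ne_zero _ (tt_ne_zero K))

lemma conj_apply (m n : ℕ) (g : GL (Fin 3) (LaurentSeries K)) (i j) :
    ((xx K m n)⁻¹ * g * xx K m n).1 i j =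
      (tt K ^ expo m n i)⁻¹ * g.1 i j * tt K ^ expo m n j := by
  rw [Units.val_mul, Units.val_mul, xx_val, xx_inv_val, Matrix.mul_diagonal, Matrix.diagonal_mul]

lemma conj_det (m n : ℕ) (g : GL (Fin 3) (LaurentSeries K)) :
    ((xx K m n)⁻¹ * g * xx K m n).1.det = g.1.det := by
  rw [Units.val_mul, Units.val_mul, Matrix.det_mul, Matrix.det_mul, mul_right_comm,
    ← Matrix.det_mul, ← Units.val_mul]
  simp

lemma unit_O (p : K[X]) (hp : IsUnit p) : iota K p ∈ Osub K ∧ (iota K p)⁻¹ ∈ Osub K := by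
  obtain ⟨c, hc, rfl⟩ := Polynomial.isUnit_iff.1 hp
  have : iota K (Polynomial.C c) = HahnSeries.C c := by simp [iota]
  rw [this, ← map_inv₀]
  exact ⟨⟨PowerSeries.C c, by simp⟩, ⟨PowerSeries.C c⁻¹, by simp⟩⟩

lemma proj_eq_iff (g h : GL (Fin 3) (LaurentSeries K)) : projPGL K g = projPGL K h ↔
    ∃ c : (LaurentSeries K)ˣ, ∀ i j, h.1 i j = g.1 i j * c := by
  unfold projPGL
  change (QuotientGroup.mk g : _ ⧸ scalarSubgroup K) = QuotientGroup.mk h ↔ _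
  rw [QuotientGroup.eq]
  constructor
  · rintro ⟨c, hc⟩
    refine ⟨c, fun i j => ?_⟩
    have : h = g * (Units.map ((Matrix.scalar (Fin 3) :
      LaurentSeries K →+* Matrix (Fin 3) (Fin 3) (LaurentSeries K))).toMonoidHom) c := by
      rw [hc]; group
    rw [this]
    simp [Matrix.scalar_apply, Matrix.mul_diagonal]
  · rintro ⟨c, hc⟩
    refine ⟨c, ?_⟩
    rw [eq_inv_mul_iff_mul_eq]
    ext i j : 2
    rw [hc]
    simp [Matrix.scalar_apply, Matrix.mul_diagonal]

lemma stab_eq (m n : ℕ) : stab K m n =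
    Set.range (fun A : SS K m n => projPGL K (toGL K A.1 A.2.2)) := by
  ext y
  constructor
  · rintro ⟨⟨g, hg, rfl⟩, ⟨w, hw, hwg⟩⟩
    obtain ⟨A, hA, rfl⟩ := gamma_toGL K g hg
    have hx : xbar K m n = projPGL K (xx K m n) := rfl
    rw [hx, ← map_inv, ← map_mul, ← map_mul, proj_eq_iff] at hwg
    obtain ⟨c, hc⟩ := hwg
    refine ⟨⟨A, ?_, hA⟩, rfl⟩
    have hcO : (c : LaurentSeries K) ∈ Osub K := by
      apply O_of_cube
      have h1 : ((xx K m n)⁻¹ * toGL K A hA * xx K m n).1 = (c : LaurentSeries K) • w.1 := by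
        ext i j : 1
        rw [hc, Matrix.smul_apply, smul_eq_mul, mul_comm]
      have h2 := congrArg Matrix.det h1
      rw [conj_det, Matrix.det_smul] at h2
      have h3 : (toGL K A hA).1.det = iota K A.det := by
        rw [RingHom.map_det]; rfl
      have h4 : w.1.det * (w⁻¹).1.det = 1 := by
        rw [← Matrix.det_mul, ← Units.val_mul]; simp
      have h5 : (c : LaurentSeries K)^3 = iota K A.det * (w⁻¹).1.det := by
        rw [← h3, h2, mul_assoc, h4]; simp
      rw [h5]
      exact mul_mem (unit_O K _ hA).1 (map_subring_inv _ _ hw.2).1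
    intro i j
    rw [← iota_mem_O]
    have := hc i j
    rw [conj_apply, toGL_apply] at this
    rw [this]
    exact mul_mem (hw.1 i j) hcO
  · rintro ⟨⟨A, hA, hu⟩, rfl⟩
    refine ⟨⟨_, toGL_gamma K A hu, rfl⟩, ⟨(xx K m n)⁻¹ * toGL K A hu * xx K m n, ?_, ?_⟩⟩
    · have h1 : ∀ i j, ((xx K m n)⁻¹ * toGL K A hu * xx K m n).1 i j ∈ Osub K := by
        intro i j
        rw [conj_apply, toGL_apply, iota_mem_O]
        exact hA i j
      refine ⟨h1, fun i j => ?_⟩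
      rw [Matrix.coe_units_inv, Matrix.inv_def, Matrix.smul_apply, Ring.inverse_eq_inv', conj_det]
      have h3 : (toGL K A hu).1.det = iota K A.det := by
        rw [RingHom.map_det]; rfl
      rw [h3]
      exact mul_mem (unit_O K _ hu).2 ((map_subring_inv _ _ h1).2 i j)
    · rw [map_mul, map_mul, map_inv]; rfl

lemma fiber (A B : Matrix (Fin 3) (Fin 3) K[X]) (hA : IsUnit A.det) (hB : IsUnit B.det) :
    projPGL K (toGL K A hA) = projPGL K (toGL K B hB) ↔
      ∃ c : Kˣ, B = Polynomial.C (c:K) • A := by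
  rw [proj_eq_iff]
  constructor
  · rintro ⟨c, hc⟩
    -- c lies in R, and so does its inverse
    have key : ∀ (A B : Matrix (Fin 3) (Fin 3) K[X]) (_ : IsUnit A.det)
        (c : LaurentSeries K), (∀ i j, iota K (B i j) = iota K (A i j) * c) →
        ∃ p, iota K p = c := by
      intro A B hA c hc
      refine ⟨(A⁻¹ * B) 0 0, ?_⟩
      rw [Matrix.mul_apply, map_sum]
      simp only [map_mul, hc, ← mul_assoc]
      rw [← Finset.sum_mul]
      simp only [← map_mul]
      rw [← map_sum, ← Matrix.mul_apply, Matrix.nonsing_inv_mul _ hA]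
      simp
    obtain ⟨p, hp⟩ := key A B hA c hc
    obtain ⟨p', hp'⟩ := key B A hB (c⁻¹ : (LaurentSeries K)ˣ) (by
      intro i j
      have := hc i j
      rw [toGL_apply, toGL_apply] at this
      rw [this]; simp [mul_assoc])
    have hpp : p * p' = 1 := by
      apply iota_inj K
      rw [map_mul, hp, hp']; simp
    obtain ⟨a, ha, rfl⟩ := Polynomial.isUnit_iff.1 (IsUnit.of_mul_eq_one _ hpp)
    refine ⟨ha.unit, ?_⟩
    ext i j : 1
    apply iota_inj K
    have := hc i j
    rw [toGL_apply, toGL_apply] at this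
    rw [this, ← hp, Matrix.smul_apply, smul_eq_mul, map_mul, mul_comm]; rfl
  · rintro ⟨c, rfl⟩
    refine ⟨Units.map (HahnSeries.C : K →+* LaurentSeries K).toMonoidHom c, fun i j => ?_⟩
    rw [toGL_apply, toGL_apply, Matrix.smul_apply, smul_eq_mul, map_mul, mul_comm]
    congr 1
    simp [iota]

lemma smul_SS (m n : ℕ) (c : Kˣ) (A) (hA : A ∈ SS K m n) :
    Polynomial.C (c:K) • A ∈ SS K m n := by
  refine ⟨fun i j k hk => ?_, ?_⟩
  · simp [hA.1 i j k hk]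
  · rw [Matrix.det_smul]
    exact ((Polynomial.isUnit_C.2 c.isUnit).pow _).mul hA.2

lemma card_stab_mul (m n : ℕ) : Nat.card (stab K m n) * (Fintype.card K - 1) =
    Nat.card (SS K m n) := by
  classical
  have hs : ∀ y : stab K m n, ∃ A : SS K m n, projPGL K (toGL K A.1 A.2.2) = y.1 := by
    intro y
    have h : ∀ z ∈ stab K m n, ∃ A : SS K m n, projPGL K (toGL K A.1 A.2.2) = z := by
      intro z hz
      rw [stab_eq] at hz
      exact hz
    exact h y.1 y.2
  choose s hs using hs
  rw [← Fintype.card_units, ← Nat.card_eq_fintype_card, ← Nat.card_prod]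
  apply Nat.card_congr
  refine Equiv.ofBijective (fun yc => ⟨Polynomial.C (yc.2:K) • (s yc.1).1,
    smul_SS K m n yc.2 _ (s yc.1).2⟩) ⟨?_, ?_⟩
  · rintro ⟨y, c⟩ ⟨y', c'⟩ h
    have h : Polynomial.C (c:K) • (s y).1 = Polynomial.C (c':K) • (s y').1 := congrArg Subtype.val h
    have e1 := (fiber K (s y).1 _ (s y).2.2 (smul_SS K m n c _ (s y).2).2).2 ⟨c, rfl⟩
    have e2 := (fiber K (s y').1 _ (s y').2.2 (smul_SS K m n c' _ (s y').2).2).2 ⟨c', rfl⟩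
    simp only [h] at e1
    have hy : y = y' := Subtype.ext (by rw [← hs, ← hs, e1, e2])
    subst hy
    have hne : (s y).1 ≠ 0 := by
      intro h0
      have := (s y).2.2
      rw [h0] at this
      simp at this
    have : Polynomial.C (c:K) = Polynomial.C (c':K) := smul_left_injective _ hne h
    have := Polynomial.C_injective this
    rw [Units.ext this]
  · intro A
    have hy : projPGL K (toGL K A.1 A.2.2) ∈ stab K m n := by rw [stab_eq]; exact ⟨A, rfl⟩
    obtain ⟨c, hc⟩ := (fiber K _ _ (s ⟨_, hy⟩).2.2 A.2.2).1 (hs ⟨_, hy⟩)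
    exact ⟨(⟨_, hy⟩, c), Subtype.ext hc.symm⟩

lemma card_degreeLT (n : ℕ) : Nat.card (degreeLT K n) = Fintype.card K ^ n := by
  rw [Nat.card_congr (degreeLTEquiv K n).toEquiv, Nat.card_eq_fintype_card]
  simp

def bd (a b : ℕ) (p : K[X]) : Prop := ∀ k, a < k + b → p.coeff k = 0

lemma bd_zero (a b : ℕ) : bd K a b 0 := fun k _ => by simp

lemma bd_C (a b : ℕ) (h : b ≤ a) (c : K) : bd K a b (Polynomial.C c) := fun k hk => by
  rw [Polynomial.coeff_C, if_neg]; omega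

lemma bd_degreeLT (a b d : ℕ) (h : b + d = a) (p : K[X]) :
    bd K a b p ↔ p ∈ degreeLT K (d + 1) := by
  rw [Polynomial.mem_degreeLT, Polynomial.degree_lt_iff_coeff_zero]
  constructor
  · intro hp k hk
    exact hp k (by omega)
  · intro hp k hk
    exact hp k (by omega)

lemma bd_lt (a b : ℕ) (h : a < b) (p : K[X]) (hp : bd K a b p) : p = 0 := by
  ext k
  rw [hp k (by omega)]; simp

lemma bd_eq (a : ℕ) (p : K[X]) (hp : bd K a a p) : p = Polynomial.C (p.coeff 0) := by
  ext k
  rw [Polynomial.coeff_C]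
  split_ifs with h
  · rw [h]
  · exact hp k (by omega)

lemma SS_iff (m n : ℕ) (A : Matrix (Fin 3) (Fin 3) K[X]) : A ∈ SS K m n ↔
    (bd K m m (A 0 0) ∧ bd K m n (A 0 1) ∧ bd K m 0 (A 0 2) ∧
    bd K n m (A 1 0) ∧ bd K n n (A 1 1) ∧ bd K n 0 (A 1 2) ∧
    bd K 0 m (A 2 0) ∧ bd K 0 n (A 2 1) ∧ bd K 0 0 (A 2 2)) ∧ IsUnit A.det := by
  refine and_congr_left fun _ => ?_
  constructor
  · intro h
    exact ⟨h 0 0, h 0 1, h 0 2, h 1 0, h 1 1, h 1 2, h 2 0, h 2 1, h 2 2⟩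
  · rintro ⟨h1, h2, h3, h4, h5, h6, h7, h8, h9⟩ i j
    fin_cases i <;> fin_cases j <;> assumption

lemma card_SS_gen (m n : ℕ) (hnm : n < m) (hn : 0 < n) :
    Nat.card (SS K m n) = (Fintype.card K - 1)^3 * Fintype.card K ^ (2*m+3) := by
  classical
  have e : Nat.card (Kˣ × Kˣ × Kˣ × degreeLT K (m-n+1) × degreeLT K (m+1) × degreeLT K (n+1)) =
      (Fintype.card K - 1)^3 * Fintype.card K ^ (2*m+3) := by
    simp only [Nat.card_prod, card_degreeLT, Nat.card_eq_fintype_card (α := Kˣ),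
      Fintype.card_units]
    rw [show 2*m+3 = (m-n+1)+((m+1)+(n+1)) by omega, pow_add, pow_add]
    ring
  rw [← e]
  symm
  refine Nat.card_congr (Equiv.ofBijective (fun x =>
    ⟨!![Polynomial.C (x.1:K), x.2.2.2.1.1, x.2.2.2.2.1.1;
       0, Polynomial.C (x.2.1:K), x.2.2.2.2.2.1;
       0, 0, Polynomial.C (x.2.2.1:K)], ?_⟩) ⟨?_, ?_⟩)
  · rw [SS_iff]
    obtain ⟨a, b, c, p, r, s⟩ := x
    refine ⟨⟨bd_C K _ _ le_rfl _, (bd_degreeLT K _ _ _ (by omega) _).2 p.2,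
      (bd_degreeLT K _ _ _ (by omega) _).2 r.2, bd_zero K _ _, bd_C K _ _ le_rfl _,
      (bd_degreeLT K _ _ _ (by omega) _).2 s.2, bd_zero K _ _, bd_zero K _ _,
      bd_C K _ _ le_rfl _⟩, ?_⟩
    rw [Matrix.det_fin_three]
    simp
  · rintro ⟨a, b, c, p, r, s⟩ ⟨a', b', c', p', r', s'⟩ h
    have h := congrArg Subtype.val h
    have h00 := congrFun (congrFun h 0) 0
    have h01 := congrFun (congrFun h 0) 1
    have h02 := congrFun (congrFun h 0) 2
    have h11 := congrFun (congrFun h 1) 1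
    have h12 := congrFun (congrFun h 1) 2
    have h22 := congrFun (congrFun h 2) 2
    simp [Units.val_inj] at h00 h01 h02 h11 h12 h22
    simp [*]
  · rintro ⟨A, hA⟩
    obtain ⟨⟨h00, h01, h02, h10, h11, h12, h20, h21, h22⟩, hu⟩ := (SS_iff K m n A).1 hA
    replace h10 := bd_lt K _ _ (by omega) _ h10
    replace h20 := bd_lt K _ _ (by omega) _ h20
    replace h21 := bd_lt K _ _ (by omega) _ h21
    replace h00 := bd_eq K _ _ h00
    replace h11 := bd_eq K _ _ h11
    replace h22 := bd_eq K _ _ h22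
    rw [bd_degreeLT K _ _ (m-n) (by omega)] at h01
    rw [bd_degreeLT K _ _ m (by omega)] at h02
    rw [bd_degreeLT K _ _ n (by omega)] at h12
    rw [Matrix.det_fin_three, h10, h20, h21, h00, h11, h22] at hu
    simp at hu
    obtain ⟨⟨ha, hb⟩, hc⟩ := hu
    refine ⟨(Units.mk0 _ ha, Units.mk0 _ hb, Units.mk0 _ hc, ⟨_, h01⟩, ⟨_, h02⟩, ⟨_, h12⟩), ?_⟩
    apply Subtype.ext
    ext i j : 1
    fin_cases i <;> fin_cases j <;> simp [h10, h20, h21, ← h00, ← h11, ← h22]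

lemma card_GL2 : Nat.card (GL (Fin 2) K) =
    Fintype.card K * (Fintype.card K + 1) * (Fintype.card K - 1)^2 := by
  rw [Matrix.card_GL_field]
  obtain ⟨r, hr⟩ : ∃ r, Fintype.card K = r + 1 := ⟨Fintype.card K - 1, by
    have := Fintype.card_pos (α := K); omega⟩
  simp only [Fin.prod_univ_two, hr]
  have h1 : (r+1)^2 - (r+1)^((0 : Fin 2):ℕ) = r * (r+2) := by
    apply Nat.sub_eq_of_eq_add; simp; ring
  have h2 : (r+1)^2 - (r+1)^((1 : Fin 2):ℕ) = r * (r+1) := by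
    apply Nat.sub_eq_of_eq_add; simp; ring
  rw [h1, h2, Nat.add_sub_cancel]; ring

lemma card_GL3 : Nat.card (GL (Fin 3) K) =
    Fintype.card K^3 * (Fintype.card K + 1) * (Fintype.card K^2 + Fintype.card K + 1)
      * (Fintype.card K - 1)^3 := by
  rw [Matrix.card_GL_field]
  obtain ⟨r, hr⟩ : ∃ r, Fintype.card K = r + 1 := ⟨Fintype.card K - 1, by
    have := Fintype.card_pos (α := K); omega⟩
  simp only [Fin.prod_univ_three, hr]
  have h1 : (r+1)^3 - (r+1)^((0 : Fin 3):ℕ) = r * ((r+1)^2+(r+1)+1) := by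
    apply Nat.sub_eq_of_eq_add; simp; ring
  have h2 : (r+1)^3 - (r+1)^((1 : Fin 3):ℕ) = r * (r+1) * (r + 2) := by
    apply Nat.sub_eq_of_eq_add; simp; ring
  have h3 : (r+1)^3 - (r+1)^((2 : Fin 3):ℕ) = r * (r+1)^2 := by
    apply Nat.sub_eq_of_eq_add; simp; ring
  rw [h1, h2, h3, Nat.add_sub_cancel]; ring

lemma GL2_det (g : GL (Fin 2) K) : g.1 0 0 * g.1 1 1 - g.1 0 1 * g.1 1 0 ≠ 0 := by
  rw [← Matrix.det_fin_two]
  exact ((Matrix.isUnit_iff_isUnit_det _).1 g.isUnit).ne_zero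

lemma card_SS_mm (m : ℕ) (hm : 0 < m) :
    Nat.card (SS K m m) = Fintype.card K ^ (2*m+3) * (Fintype.card K + 1) *
      (Fintype.card K - 1)^3 := by
  classical
  have e : Nat.card (GL (Fin 2) K × Kˣ × degreeLT K (m+1) × degreeLT K (m+1)) =
      Fintype.card K ^ (2*m+3) * (Fintype.card K + 1) * (Fintype.card K - 1)^3 := by
    simp only [Nat.card_prod, card_degreeLT, Nat.card_eq_fintype_card (α := Kˣ),
      Fintype.card_units, card_GL2]
    ring
  rw [← e]
  symm
  refine Nat.card_congr (Equiv.ofBijective (fun x =>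
    ⟨!![Polynomial.C (x.1.1 0 0), Polynomial.C (x.1.1 0 1), x.2.2.1.1;
       Polynomial.C (x.1.1 1 0), Polynomial.C (x.1.1 1 1), x.2.2.2.1;
       0, 0, Polynomial.C (x.2.1:K)], ?_⟩) ⟨?_, ?_⟩)
  · rw [SS_iff]
    obtain ⟨g, c, p, r⟩ := x
    refine ⟨⟨bd_C K _ _ le_rfl _, bd_C K _ _ le_rfl _,
      (bd_degreeLT K _ _ _ (by omega) _).2 p.2, bd_C K _ _ le_rfl _, bd_C K _ _ le_rfl _,
      (bd_degreeLT K _ _ _ (by omega) _).2 r.2, bd_zero K _ _, bd_zero K _ _,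
      bd_C K _ _ le_rfl _⟩, ?_⟩
    have h := ((GL2_det K g).isUnit.mul c.isUnit).map (Polynomial.C : K →+* K[X])
    convert h using 1
    rw [Matrix.det_fin_three]
    simp
    ring
  · rintro ⟨g, c, p, r⟩ ⟨g', c', p', r'⟩ h
    have h := congrArg Subtype.val h
    have h00 := congrFun (congrFun h 0) 0
    have h01 := congrFun (congrFun h 0) 1
    have h02 := congrFun (congrFun h 0) 2
    have h10 := congrFun (congrFun h 1) 0
    have h11 := congrFun (congrFun h 1) 1
    have h12 := congrFun (congrFun h 1) 2
    have h22 := congrFun (congrFun h 2) 2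
    simp [Units.val_inj] at h00 h01 h02 h10 h11 h12 h22
    have hg : g = g' := by
      ext i j : 2
      fin_cases i <;> fin_cases j <;> assumption
    simp [*]
  · rintro ⟨A, hA⟩
    obtain ⟨⟨h00, h01, h02, h10, h11, h12, h20, h21, h22⟩, hu⟩ := (SS_iff K m m A).1 hA
    replace h20 := bd_lt K _ _ (by omega) _ h20
    replace h21 := bd_lt K _ _ (by omega) _ h21
    replace h00 := bd_eq K _ _ h00
    replace h01 := bd_eq K _ _ h01
    replace h10 := bd_eq K _ _ h10
    replace h11 := bd_eq K _ _ h11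
    replace h22 := bd_eq K _ _ h22
    rw [bd_degreeLT K _ _ m (by omega)] at h02
    rw [bd_degreeLT K _ _ m (by omega)] at h12
    have hd : A.det = Polynomial.C ((!![(A 0 0).coeff 0, (A 0 1).coeff 0;
        (A 1 0).coeff 0, (A 1 1).coeff 0]).det * (A 2 2).coeff 0) := by
      rw [Matrix.det_fin_three, h20, h21, Matrix.det_fin_two_of]
      simp only [map_mul, map_sub, ← h00, ← h01, ← h10, ← h11, ← h22]
      ring
    rw [hd, Polynomial.isUnit_C, isUnit_iff_ne_zero, mul_ne_zero_iff] at hu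
    refine ⟨(Matrix.GeneralLinearGroup.mkOfDetNeZero _ hu.1, Units.mk0 _ hu.2,
      ⟨_, h02⟩, ⟨_, h12⟩), ?_⟩
    apply Subtype.ext
    ext i j : 1
    fin_cases i <;> fin_cases j <;>
      simp [h20, h21, ← h00, ← h01, ← h10, ← h11, ← h22, Matrix.GeneralLinearGroup.mkOfDetNeZero]

lemma card_SS_m0 (m : ℕ) (hm : 0 < m) :
    Nat.card (SS K m 0) = Fintype.card K ^ (2*m+3) * (Fintype.card K + 1) *
      (Fintype.card K - 1)^3 := by
  classical
  have e : Nat.card (GL (Fin 2) K × Kˣ × degreeLT K (m+1) × degreeLT K (m+1)) =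
      Fintype.card K ^ (2*m+3) * (Fintype.card K + 1) * (Fintype.card K - 1)^3 := by
    simp only [Nat.card_prod, card_degreeLT, Nat.card_eq_fintype_card (α := Kˣ),
      Fintype.card_units, card_GL2]
    ring
  rw [← e]
  symm
  refine Nat.card_congr (Equiv.ofBijective (fun x =>
    ⟨!![Polynomial.C (x.2.1:K), x.2.2.1.1, x.2.2.2.1;
       0, Polynomial.C (x.1.1 0 0), Polynomial.C (x.1.1 0 1);
       0, Polynomial.C (x.1.1 1 0), Polynomial.C (x.1.1 1 1)], ?_⟩) ⟨?_, ?_⟩)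
  · rw [SS_iff]
    obtain ⟨g, c, p, r⟩ := x
    refine ⟨⟨bd_C K _ _ le_rfl _,
      (bd_degreeLT K _ _ _ (by omega) _).2 p.2, (bd_degreeLT K _ _ _ (by omega) _).2 r.2,
      bd_zero K _ _, bd_C K _ _ le_rfl _, bd_C K _ _ le_rfl _,
      bd_zero K _ _, bd_C K _ _ le_rfl _, bd_C K _ _ le_rfl _⟩, ?_⟩
    have h := ((GL2_det K g).isUnit.mul c.isUnit).map (Polynomial.C : K →+* K[X])
    convert h using 1
    rw [Matrix.det_fin_three]
    simp
    ring
  · rintro ⟨g, c, p, r⟩ ⟨g', c', p', r'⟩ h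
    have h := congrArg Subtype.val h
    have h00 := congrFun (congrFun h 0) 0
    have h01 := congrFun (congrFun h 0) 1
    have h02 := congrFun (congrFun h 0) 2
    have h21 := congrFun (congrFun h 2) 1
    have h11 := congrFun (congrFun h 1) 1
    have h12 := congrFun (congrFun h 1) 2
    have h22 := congrFun (congrFun h 2) 2
    simp [Units.val_inj] at h00 h01 h02 h21 h11 h12 h22
    have hg : g = g' := by
      ext i j : 2
      fin_cases i <;> fin_cases j <;> assumption
    simp [*]
  · rintro ⟨A, hA⟩
    obtain ⟨⟨h00, h01, h02, h10, h11, h12, h20, h21, h22⟩, hu⟩ := (SS_iff K m 0 A).1 hA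
    replace h20 := bd_lt K _ _ (by omega) _ h20
    replace h10 := bd_lt K _ _ (by omega) _ h10
    replace h00 := bd_eq K _ _ h00
    replace h12 := bd_eq K _ _ h12
    replace h21 := bd_eq K _ _ h21
    replace h11 := bd_eq K _ _ h11
    replace h22 := bd_eq K _ _ h22
    rw [bd_degreeLT K _ _ m (by omega)] at h01
    rw [bd_degreeLT K _ _ m (by omega)] at h02
    have hd : A.det = Polynomial.C ((!![(A 1 1).coeff 0, (A 1 2).coeff 0;
        (A 2 1).coeff 0, (A 2 2).coeff 0]).det * (A 0 0).coeff 0) := by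
      rw [Matrix.det_fin_three, h20, h10, Matrix.det_fin_two_of]
      simp only [map_mul, map_sub, ← h00, ← h12, ← h21, ← h11, ← h22]
      ring
    rw [hd, Polynomial.isUnit_C, isUnit_iff_ne_zero, mul_ne_zero_iff] at hu
    refine ⟨(Matrix.GeneralLinearGroup.mkOfDetNeZero _ hu.1, Units.mk0 _ hu.2,
      ⟨_, h01⟩, ⟨_, h02⟩), ?_⟩
    apply Subtype.ext
    ext i j : 1
    fin_cases i <;> fin_cases j <;>
      simp [h20, h10, ← h00, ← h12, ← h21, ← h11, ← h22, Matrix.GeneralLinearGroup.mkOfDetNeZero]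

lemma card_SS_00 : Nat.card (SS K 0 0) =
    Fintype.card K^3 * (Fintype.card K + 1) * (Fintype.card K^2 + Fintype.card K + 1)
      * (Fintype.card K - 1)^3 := by
  classical
  rw [← card_GL3]
  symm
  refine Nat.card_congr (Equiv.ofBijective (fun g =>
    ⟨(Polynomial.C : K →+* K[X]).mapMatrix g.1, ?_⟩) ⟨?_, ?_⟩)
  · constructor
    · intro i j k hk
      have : k ≠ 0 := by fin_cases i <;> fin_cases j <;> simp [expo] at hk <;> omega
      simp [Polynomial.coeff_C, this]
    · rw [← RingHom.map_det]
      exact ((Matrix.isUnit_iff_isUnit_det _).1 g.isUnit).map _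
  · intro g g' h
    have h := congrArg Subtype.val h
    ext i j : 2
    have := congrFun (congrFun h i) j
    simpa using this
  · rintro ⟨A, hA, hu⟩
    have h1 : A = (Polynomial.C : K →+* K[X]).mapMatrix (Matrix.of fun i j => (A i j).coeff 0) := by
      ext i j : 1
      apply bd_eq K 0
      intro k hk
      apply hA i j k
      fin_cases i <;> fin_cases j <;> simpa [expo] using hk
    rw [h1, ← RingHom.map_det] at hu
    have hu' := Polynomial.isUnit_C.1 hu
    exact ⟨Matrix.GeneralLinearGroup.mkOfDetNeZero _ hu'.ne_zero, Subtype.ext h1.symm⟩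

/-- The cardinalities `N_{m,n}` of the stabilizers `Γ̄_{m,n}`, where `q = |𝔽_q|`. -/
theorem card_stab (q : ℕ) (hq : q = Fintype.card K) :
    Nat.card ↥(stab K 0 0) = q^3 * (q+1) * (q^2+q+1) * (q-1)^2 ∧
    (∀ m : ℕ, 0 < m → Nat.card ↥(stab K m 0) = q^(2*m+3) * (q+1) * (q-1)^2) ∧
    (∀ m n : ℕ, n < m → 0 < n → Nat.card ↥(stab K m n) = q^(2*m+3) * (q-1)^2) ∧
    (∀ m : ℕ, 0 < m → Nat.card ↥(stab K m m) = q^(2*m+3) * (q+1) * (q-1)^2) := by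
  subst hq
  have hpos : 0 < Fintype.card K - 1 := by
    have := Fintype.one_lt_card (α := K)
    omega
  refine ⟨?_, fun m hm => ?_, fun m n hnm hn => ?_, fun m hm => ?_⟩ <;>
    apply Nat.eq_of_mul_eq_mul_right hpos <;> rw [card_stab_mul]
  · rw [card_SS_00]; ring
  · rw [card_SS_m0 K m hm]; ring
  · rw [card_SS_gen K m n hnm hn]; ring
  · rw [card_SS_mm K m hm]; ring
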